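/- For every subspace H of ℝ^n, the function (t_1,...,t_n) ↦ vol_H(diag(e^{t_1},...,e^{t_n}) B_1^n ∩ H) is log-concave on ℝ^n, where B_1^n = {x ∈ ℝ^n : ∑|x_i| ≤ 1} and vol_H denotes Lebesgue measure on H. -/

import Mathlib

open MeasureTheory
open scoped ENNReal Pointwise

lemma bm_compact {A B C : Set ℝ} (hA : IsCompact A) (hB : IsCompact B) (hA' : A.Nonempty)
    (hB' : B.Nonempty) (h : ∀ a ∈ A, ∀ b ∈ B, a + b ∈ C) :
    volume A + volume B ≤ volume C := by
  have ha := hA.sSup_mem hA'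
  have hb := hB.sInf_mem hB'
  set a := sSup A
  set b := sInf B
  have h1 : volume ((fun x => x + b) '' A) = volume A := by
    simp [Set.image_add_right]
  have h2 : volume ((fun x => a + x) '' B) = volume B := by
    simp [Set.image_add_left]
  rw [← h1, ← h2, ← measure_union₀]
  · apply measure_mono
    rintro _ (⟨x, hx, rfl⟩ | ⟨x, hx, rfl⟩)
    · exact h _ hx _ hb
    · exact h _ ha _ hx
  · exact (hB.image (by fun_prop)).measurableSet.nullMeasurableSet
  · refine measure_mono_null (t := {a + b}) ?_ (by simp)
    rintro _ ⟨⟨x, hx, rfl⟩, ⟨y, hy, hxy⟩⟩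
    have := le_csSup hA.bddAbove hx
    have := csInf_le hB.bddBelow hy
    simp only [Set.mem_singleton_iff] at *
    linarith

lemma bm_meas {A B C : Set ℝ} (hA : MeasurableSet A) (hB : MeasurableSet B) (hA' : A.Nonempty)
    (hB' : B.Nonempty) (h : ∀ a ∈ A, ∀ b ∈ B, a + b ∈ C) :
    volume A + volume B ≤ volume C := by
  rw [hA.measure_eq_iSup_isCompact, hB.measure_eq_iSup_isCompact]
  simp only [iSup_and']
  obtain ⟨a, ha⟩ := hA'
  obtain ⟨b, hb⟩ := hB'
  refine ENNReal.biSup_add_biSup_le' (p := fun K => K ⊆ A ∧ IsCompact K) (q := fun K => K ⊆ B ∧ IsCompact K) ⟨∅, by simp⟩ ⟨∅, by simp⟩ ?_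
  rintro K ⟨hK, hK'⟩ L ⟨hL, hL'⟩
  calc volume K + volume L ≤ volume (insert a K) + volume (insert b L) :=
        add_le_add (measure_mono (Set.subset_insert _ _)) (measure_mono (Set.subset_insert _ _))
    _ ≤ volume C := by
        refine bm_compact (hK'.insert a) (hL'.insert b) (by simp) (by simp) fun x hx y hy => ?_
        exact h _ (Set.insert_subset ha hK hx) _ (Set.insert_subset hb hL hy)

lemma bm_l {A B C : Set ℝ} {l : ℝ} (h0 : 0 < l) (h1 : l < 1) (hA : MeasurableSet A)
    (hB : MeasurableSet B) (hA' : A.Nonempty)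
    (hB' : B.Nonempty) (h : ∀ a ∈ A, ∀ b ∈ B, l * a + (1 - l) * b ∈ C) :
    ENNReal.ofReal l * volume A + ENNReal.ofReal (1 - l) * volume B ≤ volume C := by
  have e1 : volume (l • A) = ENNReal.ofReal l * volume A := by
    rw [Measure.addHaar_smul]; simp [abs_of_pos h0]
  have e2 : volume ((1 - l) • B) = ENNReal.ofReal (1 - l) * volume B := by
    rw [Measure.addHaar_smul]; simp [abs_of_pos (sub_pos.2 h1)]
  rw [← e1, ← e2]
  refine bm_meas (hA.const_smul₀ _) (hB.const_smul₀ _) hA'.smul_set hB'.smul_set ?_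
  rintro _ ⟨a, ha, rfl⟩ _ ⟨b, hb, rfl⟩
  exact h a ha b hb

lemma pl_norm {f g h : ℝ → ℝ} {l : ℝ} (h0 : 0 < l) (h1 : l < 1)
    (hf : Measurable f) (hg : Measurable g) (hh : Measurable h)
    (f0 : ∀ x, 0 ≤ f x) (g0 : ∀ x, 0 ≤ g x) (hh0 : ∀ x, 0 ≤ h x)
    (f1 : ∀ x, f x ≤ 1) (g1 : ∀ x, g x ≤ 1)
    (fs : ∀ s < 1, ∃ x, s < f x) (gs : ∀ s < 1, ∃ x, s < g x)
    (H : ∀ x y, f x ^ l * g y ^ (1 - l) ≤ h (l * x + (1 - l) * y)) :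
    ENNReal.ofReal l * (∫⁻ x, ENNReal.ofReal (f x)) +
      ENNReal.ofReal (1 - l) * (∫⁻ x, ENNReal.ofReal (g x)) ≤ ∫⁻ x, ENNReal.ofReal (h x) := by
  have mono : ∀ u : ℝ → ℝ, Measurable fun t => volume {a | t < u a} := fun u =>
    Antitone.measurable fun s t hst => measure_mono fun x hx => lt_of_le_of_lt hst hx
  rw [lintegral_eq_lintegral_meas_lt _ (ae_of_all _ f0) hf.aemeasurable,
    lintegral_eq_lintegral_meas_lt _ (ae_of_all _ g0) hg.aemeasurable,
    lintegral_eq_lintegral_meas_lt _ (ae_of_all _ hh0) hh.aemeasurable,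
    ← lintegral_const_mul _ (mono f), ← lintegral_const_mul _ (mono g),
    ← lintegral_add_left ((mono f).const_mul _)]
  refine setLIntegral_mono (mono h) fun t ht => ?_
  rcases lt_or_ge t 1 with h' | h'
  · refine bm_l h0 h1 (measurableSet_lt measurable_const hf) (measurableSet_lt measurable_const hg)
      (fs t h') (gs t h') fun a ha b hb => ?_
    refine lt_of_lt_of_le ?_ (H a b)
    have ht : 0 < t := ht
    calc t = t ^ l * t ^ (1 - l) := by rw [← Real.rpow_add ht]; simp
      _ < f a ^ l * g b ^ (1 - l) :=
        mul_lt_mul'' (Real.rpow_lt_rpow ht.le ha h0) (Real.rpow_lt_rpow ht.le hb (by linarith))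
          (by positivity) (by positivity)
  · have e1 : {a | t < f a} = ∅ := by ext x; simpa using (f1 x).trans h'
    have e2 : {a | t < g a} = ∅ := by ext x; simpa using (g1 x).trans h'
    simp [e1, e2]


lemma ennreal_amgm {l : ℝ} (h0 : 0 < l) (h1 : l < 1) (a b : ℝ≥0∞) :
    a ^ l * b ^ (1 - l) ≤ ENNReal.ofReal l * a + ENNReal.ofReal (1 - l) * b := by
  have h1' : 0 < 1 - l := by linarith
  rcases eq_or_ne a ∞ with rfl | ha
  · rw [ENNReal.mul_top (by simpa using h0)]; simp
  rcases eq_or_ne b ∞ with rfl | hb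
  · rw [ENNReal.mul_top (by simpa using h1)]; simp
  lift a to NNReal using ha
  lift b to NNReal using hb
  have := NNReal.geom_mean_le_arith_mean2_weighted ⟨l, h0.le⟩ ⟨1 - l, h1'.le⟩ a b
    (NNReal.eq (add_sub_cancel l 1))
  rw [← ENNReal.coe_rpow_of_nonneg _ h0.le, ← ENNReal.coe_rpow_of_nonneg _ h1'.le,
    ENNReal.ofReal_eq_coe_nnreal h0.le, ENNReal.ofReal_eq_coe_nnreal h1'.le]
  exact_mod_cast this

lemma sup_aux (u : ℝ → ℝ≥0∞) (cT : (⨆ x, u x) ≠ ∞) (c0 : (⨆ x, u x) ≠ 0) (s : ℝ) (hs : s < 1) :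
    ∃ x, s < (u x / (⨆ x, u x)).toReal := by
  set c := ⨆ x, u x with hc
  have : ENNReal.ofReal s * c < c := by
    conv_rhs => rw [← one_mul c]
    exact ENNReal.mul_lt_mul_left c0 cT (by simpa using hs)
  obtain ⟨x, hx⟩ := lt_iSup_iff.1 this
  refine ⟨x, ?_⟩
  have h2 : ENNReal.ofReal s < u x / c :=
    (ENNReal.lt_div_iff_mul_lt (Or.inl c0) (Or.inl cT)).2 hx
  rw [← ENNReal.ofReal_toReal (ENNReal.div_ne_top (ne_top_of_le_ne_top cT (le_iSup u x)) c0)] at h2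
  exact (ENNReal.ofReal_lt_ofReal_iff'.1 h2).1

lemma pl_bdd {f g h : ℝ → ℝ≥0∞} {l : ℝ} (h0 : 0 < l) (h1 : l < 1)
    (hf : Measurable f) (hg : Measurable g) (hh : Measurable h) {M : ℝ≥0∞} (hM : M ≠ ∞)
    (fM : ∀ x, f x ≤ M) (gM : ∀ x, g x ≤ M)
    (H : ∀ x y, f x ^ l * g y ^ (1 - l) ≤ h (l * x + (1 - l) * y)) :
    (∫⁻ x, f x) ^ l * (∫⁻ x, g x) ^ (1 - l) ≤ ∫⁻ x, h x := by
  have h1' : 0 < 1 - l := by linarith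
  set c := ⨆ x, f x with hc
  set d := ⨆ x, g x with hd
  have hfc : ∀ x, f x ≤ c := le_iSup f
  have hgd : ∀ x, g x ≤ d := le_iSup g
  have cT : c ≠ ∞ := ne_top_of_le_ne_top hM (iSup_le fM)
  have dT : d ≠ ∞ := ne_top_of_le_ne_top hM (iSup_le gM)
  rcases eq_or_ne c 0 with c0 | c0
  · have : ∀ x, f x = 0 := fun x => le_antisymm (c0 ▸ hfc x) bot_le
    simp [this, h0]
  rcases eq_or_ne d 0 with d0 | d0
  · have : ∀ x, g x = 0 := fun x => le_antisymm (d0 ▸ hgd x) bot_le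
    simp [this, h1]
  set e := c ^ l * d ^ (1 - l) with he
  have e0 : e ≠ 0 := by
    simp [he, ENNReal.rpow_eq_zero_iff, c0, d0, cT, dT]
  have eT : e ≠ ∞ := ENNReal.mul_ne_top (ENNReal.rpow_ne_top_of_nonneg h0.le cT)
    (ENNReal.rpow_ne_top_of_nonneg h1'.le dT)
  have key := pl_norm (f := fun x => (f x / c).toReal) (g := fun x => (g x / d).toReal)
    (h := fun x => (min (h x / e) 1).toReal) h0 h1
    (hf.div_const c).ennreal_toReal (hg.div_const d).ennreal_toReal
    ((hh.div_const e).min measurable_const).ennreal_toReal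
    (fun x => ENNReal.toReal_nonneg) (fun x => ENNReal.toReal_nonneg)
    (fun x => ENNReal.toReal_nonneg)
    (fun x => ENNReal.toReal_le_of_le_ofReal zero_le_one
      (by simpa using ENNReal.div_le_of_le_mul (by simpa using hfc x)))
    (fun x => ENNReal.toReal_le_of_le_ofReal zero_le_one
      (by simpa using ENNReal.div_le_of_le_mul (by simpa using hgd x)))
    ?_ ?_ ?_
  · have fT : ∀ x, f x / c ≠ ∞ := fun x => ENNReal.div_ne_top (ne_top_of_le_ne_top cT (hfc x)) c0
    have gT : ∀ x, g x / d ≠ ∞ := fun x => ENNReal.div_ne_top (ne_top_of_le_ne_top dT (hgd x)) d0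
    have hT : ∀ x, min (h x / e) 1 ≠ ∞ := fun x => ne_top_of_le_ne_top (by simp) (min_le_right _ 1)
    simp only [ENNReal.ofReal_toReal (fT _), ENNReal.ofReal_toReal (gT _),
      ENNReal.ofReal_toReal (hT _)] at key
    have key2 := (ennreal_amgm h0 h1 _ _).trans (key.trans
      (lintegral_mono fun x => min_le_left (h x / e) 1))
    simp only [div_eq_mul_inv] at key2
    rw [lintegral_mul_const _ hf, lintegral_mul_const _ hg, lintegral_mul_const _ hh,
      ENNReal.mul_rpow_of_nonneg _ _ h0.le, ENNReal.mul_rpow_of_nonneg _ _ h1'.le,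
      mul_mul_mul_comm, ENNReal.inv_rpow, ENNReal.inv_rpow, 
      ← ENNReal.mul_inv (by simp [cT, c0]) (by simp [dT, d0]), ← he] at key2
    exact (ENNReal.mul_le_mul_iff_left (ENNReal.inv_ne_zero.2 eT) (ENNReal.inv_ne_top.2 e0)).1 key2
  · exact sup_aux f cT c0
  · exact sup_aux g dT d0
  · intro x y
    rw [ENNReal.toReal_rpow, ENNReal.toReal_rpow, ← ENNReal.toReal_mul]
    refine ENNReal.toReal_mono (ne_top_of_le_ne_top (by simp) (min_le_right _ 1)) ?_
    have : (f x / c) ^ l * (g y / d) ^ (1 - l) = f x ^ l * g y ^ (1 - l) / e := by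
      simp only [div_eq_mul_inv]
      rw [ENNReal.mul_rpow_of_nonneg _ _ h0.le, ENNReal.mul_rpow_of_nonneg _ _ h1'.le,
      mul_mul_mul_comm, ENNReal.inv_rpow, ENNReal.inv_rpow, 
      ← ENNReal.mul_inv (by simp [cT, c0]) (by simp [dT, d0]), ← he] 
    rw [this]
    refine le_min (ENNReal.div_le_div_right (H x y) _) (ENNReal.div_le_of_le_mul ?_)
    rw [one_mul]
    exact mul_le_mul' (ENNReal.rpow_le_rpow (hfc x) h0.le) (ENNReal.rpow_le_rpow (hgd y) h1'.le)

lemma pl_one {f g h : ℝ → ℝ≥0∞} {l : ℝ} (h0 : 0 < l) (h1 : l < 1)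
    (hf : Measurable f) (hg : Measurable g) (hh : Measurable h)
    (H : ∀ x y, f x ^ l * g y ^ (1 - l) ≤ h (l * x + (1 - l) * y)) :
    (∫⁻ x, f x) ^ l * (∫⁻ x, g x) ^ (1 - l) ≤ ∫⁻ x, h x := by
  have h1' : 0 < 1 - l := by linarith
  rcases eq_or_ne (∫⁻ x, f x) 0 with c0 | c0
  · simp [c0, h0]
  rcases eq_or_ne (∫⁻ x, g x) 0 with d0 | d0
  · simp [d0, h1]
  have tr : ∀ u : ℝ → ℝ≥0∞, Measurable u → Filter.Tendsto (fun N : ℕ => ∫⁻ x, min (u x) N)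
      Filter.atTop (nhds (∫⁻ x, u x)) := by
    intro u hu
    refine lintegral_tendsto_of_tendsto_of_monotone (fun N => (hu.min measurable_const).aemeasurable)
      (ae_of_all _ fun x m n hmn => min_le_min le_rfl (by exact_mod_cast hmn)) (ae_of_all _ fun x => ?_)
    have := (tendsto_const_nhds (x := u x)).min ENNReal.tendsto_nat_nhds_top
    simpa using this
  have t1 := (ENNReal.continuous_rpow_const (y := l)).continuousAt.tendsto.comp (tr f hf)
  have t2 := (ENNReal.continuous_rpow_const (y := 1 - l)).continuousAt.tendsto.comp (tr g hg)
  refine le_of_tendsto (ENNReal.Tendsto.mul t1 (Or.inl ?_) t2 (Or.inl ?_)) (Filter.Eventually.of_forall fun N => ?_)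
  · simp [ENNReal.rpow_eq_zero_iff, c0, h0.le]
  · simp [ENNReal.rpow_eq_zero_iff, d0, h1.le]
  · refine pl_bdd h0 h1 (hf.min measurable_const) (hg.min measurable_const) hh
      (ENNReal.natCast_ne_top N) (fun x => min_le_right _ _) (fun x => min_le_right _ _) fun x y => ?_
    refine le_trans ?_ (H x y)
    exact mul_le_mul' (ENNReal.rpow_le_rpow (min_le_left _ _) h0.le)
      (ENNReal.rpow_le_rpow (min_le_left _ _) h1'.le)

lemma pl_pi {l : ℝ} (h0 : 0 < l) (h1 : l < 1) (n : ℕ) : ∀ {f g h : (Fin n → ℝ) → ℝ≥0∞} 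
    (_ : Measurable f) (_ : Measurable g) (_ : Measurable h)
    (_ : ∀ x y, f x ^ l * g y ^ (1 - l) ≤ h (l • x + (1 - l) • y)),
    (∫⁻ x, f x) ^ l * (∫⁻ x, g x) ^ (1 - l) ≤ ∫⁻ x, h x := by
  induction n with
  | zero =>
    intro f g h hf hg hh H
    have : ∀ u : (Fin 0 → ℝ) → ℝ≥0∞, ∫⁻ x, u x = u 0 := by
      intro u
      rw [Measure.volume_pi_eq_dirac 0, lintegral_dirac]
    simp only [this]
    simpa using H 0 0
  | succ n ih =>
    intro f g h hf hg hh H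
    let e := (MeasurableEquiv.piFinSuccAbove (fun _ : Fin (n+1) => ℝ) 0).symm
    have red : ∀ u : (Fin (n+1) → ℝ) → ℝ≥0∞, Measurable u →
        ∫⁻ x, u x = ∫⁻ a, ∫⁻ y, u (e (a, y)) := by
      intro u hu
      rw [← (volume_preserving_piFinSuccAbove (fun _ : Fin (n+1) => ℝ) 0).symm.lintegral_comp hu,
        Measure.volume_eq_prod]
      exact lintegral_prod _ (hu.comp e.measurable).aemeasurable
    have hm : ∀ u : (Fin (n+1) → ℝ) → ℝ≥0∞, Measurable u → ∀ a, Measurable fun y => u (e (a, y)) :=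
      fun u hu a => hu.comp (e.measurable.comp measurable_prodMk_left)
    have hm2 : ∀ u : (Fin (n+1) → ℝ) → ℝ≥0∞, Measurable u →
        Measurable fun a => ∫⁻ y, u (e (a, y)) := fun u hu =>
      (hu.comp e.measurable).lintegral_prod_right'
    rw [red f hf, red g hg, red h hh]
    refine pl_one h0 h1 (hm2 f hf) (hm2 g hg) (hm2 h hh) fun a b => ?_
    refine ih (hm f hf a) (hm g hg b) (hm h hh _) fun x y => ?_
    refine (H _ _).trans (le_of_eq ?_)
    congr 1
    ext i
    refine Fin.cases ?_ (fun j => ?_) i <;> simp [e, MeasurableEquiv.piFinSuccAbove]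

lemma lint_gauss : ∫⁻ v : ℝ, ENNReal.ofReal (Real.exp (-v ^ 2)) = ENNReal.ofReal √Real.pi := by
  have h := integral_gaussian 1
  have hi := integrable_exp_neg_mul_sq (b := 1) one_pos
  simp only [neg_mul, one_mul, div_one] at h hi
  rw [← h, ofReal_integral_eq_lintegral_ofReal hi (ae_of_all _ fun x => (Real.exp_pos _).le)]

lemma lint_gauss_Ioi : ∫⁻ v in Set.Ioi (0:ℝ), ENNReal.ofReal (Real.exp (-v ^ 2)) =
    ENNReal.ofReal (√Real.pi / 2) := by
  have h := integral_gaussian_Ioi 1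
  have hi := (integrable_exp_neg_mul_sq (b := 1) one_pos).integrableOn (s := Set.Ioi 0)
  simp only [neg_mul, one_mul, div_one] at h hi
  rw [← h, ofReal_integral_eq_lintegral_ofReal hi (ae_of_all _ fun x => (Real.exp_pos _).le)]

lemma schlomilch {b : ℝ} (hb : 0 ≤ b) :
    ∫⁻ u : ℝ, ENNReal.ofReal (Real.exp (u / 2) *
      Real.exp (-(Real.exp (u / 2) - b * Real.exp (-(u / 2))) ^ 2)) = ENNReal.ofReal √Real.pi := by
  set φ : ℝ → ℝ := fun u => Real.exp (u / 2) - b * Real.exp (-(u / 2)) with hφ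
  set φ' : ℝ → ℝ := fun u => (Real.exp (u / 2) + b * Real.exp (-(u / 2))) / 2 with hφ'
  have pos : ∀ u, 0 < φ' u := fun u => by simp only [hφ']; positivity
  have hd : ∀ u, HasDerivAt φ (φ' u) u := by
    intro u
    have h1 : HasDerivAt (fun u : ℝ => u / 2) (1 / 2) u := (hasDerivAt_id u).div_const 2
    have h2 : HasDerivAt (fun u : ℝ => -(u / 2)) (-(1 / 2)) u := h1.neg
    refine (h1.exp.sub ((h2.exp).const_mul b)).congr_deriv ?_
    simp only [hφ']; ring
  have smono : StrictMono φ := strictMono_of_hasDerivAt_pos hd pos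
  have cv := lintegral_image_eq_lintegral_abs_deriv_mul MeasurableSet.univ
    (fun x _ => (hd x).hasDerivWithinAt) smono.injective.injOn
    (fun v => ENNReal.ofReal (Real.exp (-v ^ 2)))
  simp only [abs_of_pos (pos _), Measure.restrict_univ, Set.image_univ,
    ← ENNReal.ofReal_mul (pos _).le] at cv
  have hcont : Continuous φ := by fun_prop
  rcases hb.eq_or_lt with rfl | hb
  · have : Set.range φ = Set.Ioi 0 := by
      ext v
      simp only [hφ, zero_mul, sub_zero, Set.mem_range, Set.mem_Ioi]
      constructor
      · rintro ⟨u, rfl⟩; positivity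
      · intro hv
        exact ⟨2 * Real.log v, by rw [mul_div_cancel_left₀ _ two_ne_zero, Real.exp_log hv]⟩
    rw [this, lint_gauss_Ioi] at cv
    have e : ∀ u, ENNReal.ofReal (Real.exp (u / 2) * Real.exp (-(φ u) ^ 2)) =
        ENNReal.ofReal 2 * ENNReal.ofReal (φ' u * Real.exp (-(φ u) ^ 2)) := by
      intro u
      rw [← ENNReal.ofReal_mul (by norm_num)]
      congr 1
      simp only [hφ']; ring
    calc _ = ∫⁻ u, ENNReal.ofReal 2 * ENNReal.ofReal (φ' u * Real.exp (-(φ u) ^ 2)) :=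
          lintegral_congr e
      _ = _ := by
        rw [lintegral_const_mul' _ _ (by simp), ← cv, ← ENNReal.ofReal_mul (by norm_num)]
        congr 1; ring
  · have hT : Filter.Tendsto φ Filter.atTop Filter.atTop := by
      have h1 : Filter.Tendsto (fun u : ℝ => u / 2) Filter.atTop Filter.atTop :=
        Filter.tendsto_id.atTop_div_const two_pos
      have h2 : Filter.Tendsto (fun u : ℝ => -(b * Real.exp (-(u / 2)))) Filter.atTop (nhds (-(b * 0))) :=
        ((Real.tendsto_exp_neg_atTop_nhds_zero.comp h1).const_mul b).neg
      exact (Real.tendsto_exp_atTop.comp h1).atTop_add h2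
    have refl : ∀ u, φ (2 * Real.log b - u) = - φ u := by
      intro u
      have e1 : Real.exp ((2 * Real.log b - u) / 2) = b * Real.exp (-(u/2)) := by
        rw [show (2 * Real.log b - u) / 2 = Real.log b + -(u/2) by ring, Real.exp_add, Real.exp_log hb]
      have e2 : b * Real.exp (-((2 * Real.log b - u) / 2)) = Real.exp (u/2) := by
        rw [show -((2 * Real.log b - u) / 2) = u/2 - Real.log b by ring, Real.exp_sub, Real.exp_log hb]
        field_simp
      simp only [hφ, e1, e2]; ring
    have hB : Filter.Tendsto φ Filter.atBot Filter.atBot := by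
      have h1 : Filter.Tendsto (fun u : ℝ => 2 * Real.log b - u) Filter.atBot Filter.atTop :=
        Filter.tendsto_atTop_add_const_left _ _ Filter.tendsto_neg_atBot_atTop
      have := Filter.tendsto_neg_atTop_atBot.comp (hT.comp h1)
      refine this.congr fun u => ?_
      simp [refl]
    have : Set.range φ = Set.univ := (hcont.surjective hT hB).range_eq
    rw [this, Measure.restrict_univ, lint_gauss] at cv
    rw [cv]
    have r : ∫⁻ u : ℝ, ENNReal.ofReal (Real.exp (u / 2) * Real.exp (-(φ u) ^ 2)) = 
        ∫⁻ u : ℝ, ENNReal.ofReal (b * Real.exp (-(u / 2)) * Real.exp (-(φ u) ^ 2)) := by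
      rw [← lintegral_sub_left_eq_self _ (2 * Real.log b)]
      refine lintegral_congr fun u => ?_
      rw [refl, neg_sq, show (2 * Real.log b - u) / 2 = Real.log b + -(u/2) by ring, Real.exp_add,
        Real.exp_log hb]
    have e : ∀ u, ENNReal.ofReal (φ' u * Real.exp (-(φ u) ^ 2)) =
        ENNReal.ofReal (1/2) * ENNReal.ofReal (Real.exp (u / 2) * Real.exp (-(φ u) ^ 2)) +
        ENNReal.ofReal (1/2) * ENNReal.ofReal (b * Real.exp (-(u / 2)) * Real.exp (-(φ u) ^ 2)) := by
      intro u
      rw [← ENNReal.ofReal_mul (by norm_num), ← ENNReal.ofReal_mul (by norm_num),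
        ← ENNReal.ofReal_add (by positivity) (by positivity)]
      congr 1
      simp only [hφ']; ring
    rw [lintegral_congr e, lintegral_add_left (by fun_prop), lintegral_const_mul' _ _ (by simp),
      lintegral_const_mul' _ _ (by simp), ← r, ← add_mul, ← ENNReal.ofReal_add (by norm_num) (by norm_num)]
    norm_num
    rfl

lemma laplace_mix {a : ℝ} (ha : 0 ≤ a) :
    ∫⁻ u : ℝ, ENNReal.ofReal (Real.exp (u / 2 - Real.exp u - a ^ 2 / 4 * Real.exp (-u))) =
      ENNReal.ofReal √Real.pi * ENNReal.ofReal (Real.exp (-a)) := by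
  rw [← schlomilch (b := a / 2) (by positivity), ← lintegral_mul_const' _ _ (by simp)]
  refine lintegral_congr fun u => ?_
  rw [← ENNReal.ofReal_mul (by positivity), ← Real.exp_add, ← Real.exp_add]
  congr 2
  have e1 : Real.exp u = Real.exp (u/2) ^ 2 := by rw [← Real.exp_nat_mul]; congr 1; push_cast; ring
  have e2 : Real.exp (-u) = Real.exp (-(u/2)) ^ 2 := by
    rw [← Real.exp_nat_mul]; congr 1; push_cast; ring
  have e3 : Real.exp (u/2) * Real.exp (-(u/2)) = 1 := by rw [← Real.exp_add]; simp
  rw [e1, e2]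
  linear_combination (-a) * e3
open scoped Matrix

lemma det_expand {n k : ℕ} (V : Matrix (Fin n) (Fin k) ℝ) (d : Fin n → ℝ) :
    (Vᵀ * Matrix.diagonal d * V).det =
      ∑ p : Fin k → Fin n, (∏ b, d (p b)) * (∏ b, V (p b) b) * (V.submatrix p id).det := by
  rw [Matrix.det_apply']
  have h : ∀ σ : Equiv.Perm (Fin k), (∏ i, (Vᵀ * Matrix.diagonal d * V) (σ i) i) =
      ∑ p : Fin k → Fin n, ∏ b, (V (p b) (σ b) * d (p b) * V (p b) b) := by
    intro σ
    have : ∀ a b, (Vᵀ * Matrix.diagonal d * V) a b = ∑ i, V i a * d i * V i b := by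
      intro a b
      rw [Matrix.mul_apply]
      simp only [Matrix.mul_diagonal, Matrix.transpose_apply]
    simp only [this]
    rw [Finset.prod_univ_sum]
    simp
  simp only [h, Finset.mul_sum]
  rw [Finset.sum_comm]
  refine Finset.sum_congr rfl fun p _ => ?_
  rw [← Matrix.det_transpose, Matrix.det_apply', Finset.mul_sum]
  refine Finset.sum_congr rfl fun σ _ => ?_
  simp only [Matrix.transpose_apply, Matrix.submatrix_apply, id, Finset.prod_mul_distrib]
  ring

lemma det_binet {n k : ℕ} (V : Matrix (Fin n) (Fin k) ℝ) (d : Fin n → ℝ) :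
    (k.factorial : ℝ) * (Vᵀ * Matrix.diagonal d * V).det =
      ∑ p : Fin k → Fin n, (V.submatrix p id).det ^ 2 * ∏ b, d (p b) := by
  have h : ∀ τ : Equiv.Perm (Fin k), (Vᵀ * Matrix.diagonal d * V).det =
      ∑ p : Fin k → Fin n, (∏ b, d (p b)) * (∏ b, V (p (τ b)) b) *
        ((Equiv.Perm.sign τ : ℤ) * (V.submatrix p id).det) := by
    intro τ
    rw [det_expand]
    rw [← Equiv.sum_comp (Equiv.arrowCongr τ.symm (Equiv.refl (Fin n)))]
    refine Finset.sum_congr rfl fun p _ => ?_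
    have e1 : (∏ b, d (p (τ b))) = ∏ b, d (p b) := Equiv.prod_comp τ fun b => d (p b)
    have e2 := Matrix.det_permute τ (V.submatrix p id)
    rw [Matrix.submatrix_submatrix] at e2
    simp only [Equiv.arrowCongr_apply, Equiv.coe_refl, Function.comp_def, Equiv.symm_symm, id] at *
    rw [e1, ← e2]
    rfl
  have h2 : ∑ τ : Equiv.Perm (Fin k), (Vᵀ * Matrix.diagonal d * V).det =
      (k.factorial : ℝ) * (Vᵀ * Matrix.diagonal d * V).det := by
    simp [Fintype.card_perm]
  rw [← h2, Finset.sum_congr rfl fun τ _ => h τ, Finset.sum_comm]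
  refine Finset.sum_congr rfl fun p _ => ?_
  rw [sq]
  nth_rw 2 [Matrix.det_apply']
  rw [Finset.sum_mul, Finset.sum_mul]
  refine Finset.sum_congr rfl fun τ _ => ?_
  simp only [Matrix.submatrix_apply, id]
  ring

lemma sum_exp_logconvex {ι : Type*} [Fintype ι] (c α β : ι → ℝ) (hc : ∀ i, 0 ≤ c i) {l : ℝ}
    (h0 : 0 < l) (h1 : l < 1) :
    ∑ i, c i * Real.exp (l * α i + (1 - l) * β i) ≤
      (∑ i, c i * Real.exp (α i)) ^ l * (∑ i, c i * Real.exp (β i)) ^ (1 - l) := by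
  have h1' : 0 < 1 - l := by linarith
  have hpq : (1 / l).HolderConjugate (1 / (1 - l)) := by
    rw [Real.holderConjugate_iff]
    exact ⟨by rw [lt_div_iff₀ h0]; linarith, by simp⟩
  have := Real.inner_le_Lp_mul_Lq_of_nonneg Finset.univ hpq
    (f := fun i => (c i * Real.exp (α i)) ^ l) (g := fun i => (c i * Real.exp (β i)) ^ (1 - l))
    (fun i _ => by have := hc i; positivity) (fun i _ => by have := hc i; positivity)
  have e1 : ∀ i, ((c i * Real.exp (α i)) ^ l) ^ (1 / l) = c i * Real.exp (α i) := fun i => by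
    rw [← Real.rpow_mul (by have := hc i; positivity), mul_one_div_cancel h0.ne', Real.rpow_one]
  have e2 : ∀ i, ((c i * Real.exp (β i)) ^ (1 - l)) ^ (1 / (1 - l)) = c i * Real.exp (β i) :=
    fun i => by
    rw [← Real.rpow_mul (by have := hc i; positivity), mul_one_div_cancel h1'.ne', Real.rpow_one]
  simp only [e1, e2, one_div_one_div] at this
  refine le_trans (le_of_eq (Finset.sum_congr rfl fun i _ => ?_)) this
  rw [Real.mul_rpow (hc i) (Real.exp_pos _).le, Real.mul_rpow (hc i) (Real.exp_pos _).le,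
    mul_mul_mul_comm, ← Real.rpow_add' (hc i) (by simp), ← Real.exp_mul, ← Real.exp_mul,
    ← Real.exp_add]
  simp [mul_comm]

lemma det_logconvex {n k : ℕ} (V : Matrix (Fin n) (Fin k) ℝ) (s t : Fin n → ℝ) {l : ℝ}
    (h0 : 0 < l) (h1 : l < 1) 
    (hs : 0 ≤ (Vᵀ * Matrix.diagonal (fun i => Real.exp (s i)) * V).det)
    (ht : 0 ≤ (Vᵀ * Matrix.diagonal (fun i => Real.exp (t i)) * V).det) :
    (Vᵀ * Matrix.diagonal (fun i => Real.exp ((l • s + (1 - l) • t) i)) * V).det ≤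
      (Vᵀ * Matrix.diagonal (fun i => Real.exp (s i)) * V).det ^ l *
      (Vᵀ * Matrix.diagonal (fun i => Real.exp (t i)) * V).det ^ (1 - l) := by
  have hk : (0 : ℝ) < k.factorial := by positivity
  refine le_of_mul_le_mul_left ?_ hk
  have := sum_exp_logconvex (fun p : Fin k → Fin n => (V.submatrix p id).det ^ 2)
    (fun p => ∑ b, s (p b)) (fun p => ∑ b, t (p b)) (fun p => sq_nonneg _) h0 h1
  have e : ∀ w : Fin n → ℝ, ∑ p : Fin k → Fin n, (V.submatrix p id).det ^ 2 *
      Real.exp (∑ b, w (p b)) = 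
      (k.factorial : ℝ) * (Vᵀ * Matrix.diagonal (fun i => Real.exp (w i)) * V).det := by
    intro w
    rw [det_binet]
    simp only [Real.exp_sum]
  have e2 : ∀ p : Fin k → Fin n, l * (∑ b, s (p b)) + (1 - l) * (∑ b, t (p b)) =
      ∑ b, (l • s + (1 - l) • t) (p b) := by
    intro p
    simp [Finset.sum_add_distrib, Finset.mul_sum]
  simp only [e2] at this
  rw [e, e, e, Real.mul_rpow hk.le hs, Real.mul_rpow hk.le ht, mul_mul_mul_comm,
    ← Real.rpow_add hk] at this
  simpa using this

lemma gauss_posdef {k : ℕ} {A : Matrix (Fin k) (Fin k) ℝ} (hA : A.PosDef) :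
    ∫⁻ y : Fin k → ℝ, ENNReal.ofReal (Real.exp (-(y ⬝ᵥ A *ᵥ y))) =
      ENNReal.ofReal (A.det ^ (-(1/2) : ℝ)) * 
        ∫⁻ y : Fin k → ℝ, ENNReal.ofReal (Real.exp (-(y ⬝ᵥ y))) := by
  open scoped MatrixOrder in
  obtain ⟨B, hB⟩ := CStarAlgebra.nonneg_iff_eq_star_mul_self.1
    (Matrix.nonneg_iff_posSemidef.2 hA.posSemidef)
  have hd : A.det = B.det ^ 2 := by
    rw [hB, Matrix.det_mul, Matrix.star_eq_conjTranspose, Matrix.det_conjTranspose]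
    simp [sq]
  have hp := hA.det_pos
  have hB0 : B.det ≠ 0 := by
    intro h; rw [hd, h] at hp; simp at hp
  have e : ∀ y, y ⬝ᵥ A *ᵥ y = (Matrix.toLin' B y) ⬝ᵥ (Matrix.toLin' B y) := by
    intro y
    rw [hB, Matrix.toLin'_apply, Matrix.star_eq_conjTranspose, ← Matrix.mulVec_mulVec,
      Matrix.dotProduct_mulVec, Matrix.conjTranspose_eq_transpose_of_trivial,
      Matrix.vecMul_transpose]
  simp only [e]
  have hm : Measurable fun y : Fin k → ℝ => ENNReal.ofReal (Real.exp (-(y ⬝ᵥ y))) := by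
    unfold dotProduct; fun_prop
  rw [← lintegral_map hm (LinearMap.continuous_of_finiteDimensional (Matrix.toLin' B)).measurable,
    Real.map_matrix_volume_pi_eq_smul_volume_pi hB0, lintegral_smul_measure, smul_eq_mul]
  congr 2
  rw [hd, Real.rpow_neg (sq_nonneg _), ← Real.sqrt_eq_rpow, Real.sqrt_sq_eq_abs, abs_inv]

noncomputable def gG {n k : ℕ} (V : Matrix (Fin n) (Fin k) ℝ) (w : Fin n → ℝ) : ℝ≥0∞ :=
  ∫⁻ y : Fin k → ℝ, ENNReal.ofReal (Real.exp (-∑ i, Real.exp (w i) * (V *ᵥ y) i ^ 2))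

lemma gG_logconcave {n k : ℕ} (V : Matrix (Fin n) (Fin k) ℝ) (hV : Function.Injective V.mulVec)
    (s t : Fin n → ℝ) {l : ℝ} (h0 : 0 < l) (h1 : l < 1) :
    gG V s ^ l * gG V t ^ (1 - l) ≤ gG V (l • s + (1 - l) • t) := by
  have h1' : 0 < 1 - l := by linarith
  have hP : ∀ w : Fin n → ℝ, (Vᵀ * Matrix.diagonal (fun i => Real.exp (w i)) * V).PosDef := by
    intro w
    have := (Matrix.PosDef.diagonal (d := fun i => Real.exp (w i))
      fun i => Real.exp_pos _).conjTranspose_mul_mul_same hV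
    rwa [Matrix.conjTranspose_eq_transpose_of_trivial] at this
  have e : ∀ w, gG V w = ENNReal.ofReal
      ((Vᵀ * Matrix.diagonal (fun i => Real.exp (w i)) * V).det ^ (-(1/2) : ℝ)) *
        ∫⁻ y : Fin k → ℝ, ENNReal.ofReal (Real.exp (-(y ⬝ᵥ y))) := by
    intro w
    rw [← gauss_posdef (hP w), gG]
    refine lintegral_congr fun y => ?_
    congr 3
    rw [← Matrix.mulVec_mulVec, ← Matrix.mulVec_mulVec, Matrix.dotProduct_mulVec,
      Matrix.vecMul_transpose]
    simp only [dotProduct, Matrix.mulVec_diagonal]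
    refine Finset.sum_congr rfl fun i _ => ?_
    ring
  rw [e, e, e]
  set K := ∫⁻ y : Fin k → ℝ, ENNReal.ofReal (Real.exp (-(y ⬝ᵥ y)))
  have ps := (hP s).det_pos
  have pt := (hP t).det_pos
  have pst := (hP (l • s + (1 - l) • t)).det_pos
  have key := det_logconvex V s t h0 h1 ps.le pt.le
  rw [ENNReal.mul_rpow_of_nonneg _ _ h0.le, ENNReal.mul_rpow_of_nonneg _ _ h1'.le, mul_mul_mul_comm,
    ← ENNReal.rpow_add_of_nonneg _ _ h0.le h1'.le, add_sub_cancel, ENNReal.rpow_one]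
  refine mul_le_mul_left ?_ _
  rw [ENNReal.ofReal_rpow_of_pos (by positivity), ENNReal.ofReal_rpow_of_pos (by positivity),
    ← ENNReal.ofReal_mul (by positivity)]
  refine ENNReal.ofReal_le_ofReal ?_
  rw [← Real.rpow_mul ps.le, ← Real.rpow_mul pt.le, mul_comm _ l, mul_comm _ (1 - l),
    Real.rpow_mul ps.le, Real.rpow_mul pt.le, ← Real.mul_rpow (by positivity) (by positivity)]
  exact Real.rpow_le_rpow_of_nonpos pst key (by norm_num)


lemma lint_pi_prod (n : ℕ) : ∀ (φ : Fin n → ℝ → ℝ≥0∞) (_ : ∀ i, Measurable (φ i)),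
    ∫⁻ u : Fin n → ℝ, ∏ i, φ i (u i) = ∏ i, ∫⁻ x, φ i x := by
  induction n with
  | zero =>
    intro φ _
    rw [Measure.volume_pi_eq_dirac 0, lintegral_dirac]; simp
  | succ n ih =>
    intro φ hφ
    have hu : Measurable fun u : Fin (n+1) → ℝ => ∏ i, φ i (u i) :=
      Finset.measurable_fun_prod _ fun i _ => (hφ i).comp (measurable_pi_apply i)
    have hs : Measurable fun u : Fin n → ℝ => ∏ i, φ (Fin.succ i) (u i) :=
      Finset.measurable_fun_prod _ fun i _ => (hφ (Fin.succ i)).comp (measurable_pi_apply i)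
    rw [← (volume_preserving_piFinSuccAbove (fun _ : Fin (n+1) => ℝ) 0).symm.lintegral_comp hu,
        Measure.volume_eq_prod, Fin.prod_univ_succ, ← ih _ fun i => hφ i.succ,
        ← lintegral_prod_mul (hφ 0).aemeasurable
          hs.aemeasurable]
    refine lintegral_congr fun z => ?_
    rw [Fin.prod_univ_succ]
    simp [MeasurableEquiv.piFinSuccAbove]

noncomputable def gJ {n k : ℕ} (V : Matrix (Fin n) (Fin k) ℝ) (t : Fin n → ℝ) : ℝ≥0∞ :=
  ∫⁻ y : Fin k → ℝ, ENNReal.ofReal (Real.exp (-∑ i, Real.exp (-t i) * |(V *ᵥ y) i|))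

noncomputable def gP {n k : ℕ} (V : Matrix (Fin n) (Fin k) ℝ) (t u : Fin n → ℝ) : ℝ≥0∞ :=
  ENNReal.ofReal (Real.exp (∑ i, (u i / 2 - Real.exp (u i)))) *
    gG V (fun i => -2 * t i - u i - Real.log 4)

lemma gP_meas {n k : ℕ} (V : Matrix (Fin n) (Fin k) ℝ) (t : Fin n → ℝ) :
    Measurable (gP V t) := by
  unfold gP gG
  refine Measurable.mul (by fun_prop) ?_
  refine Measurable.lintegral_prod_right' (f := fun z : (Fin n → ℝ) × (Fin k → ℝ) =>
    ENNReal.ofReal (Real.exp (-∑ i, Real.exp (-2 * t i - z.1 i - Real.log 4) * (V *ᵥ z.2) i ^ 2))) ?_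
  unfold Matrix.mulVec dotProduct
  fun_prop

lemma gJ_eq {n k : ℕ} (V : Matrix (Fin n) (Fin k) ℝ) (t : Fin n → ℝ) :
    ENNReal.ofReal √Real.pi ^ n * gJ V t = ∫⁻ u, gP V t u := by
  have step : ∀ y : Fin k → ℝ, ENNReal.ofReal √Real.pi ^ n *
      ENNReal.ofReal (Real.exp (-∑ i, Real.exp (-t i) * |(V *ᵥ y) i|)) =
      ∫⁻ u : Fin n → ℝ, ENNReal.ofReal (Real.exp (∑ i, (u i / 2 - Real.exp (u i)))) *
        ENNReal.ofReal (Real.exp (-∑ i, Real.exp (-2 * t i - u i - Real.log 4) *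
          (V *ᵥ y) i ^ 2)) := by
    intro y
    have h := lint_pi_prod n (fun i u => ENNReal.ofReal (Real.exp (u / 2 - Real.exp u -
      (Real.exp (-t i) * |(V *ᵥ y) i|) ^ 2 / 4 * Real.exp (-u)))) (fun i => by fun_prop)
    rw [Finset.prod_congr rfl fun i _ => laplace_mix (a := Real.exp (-t i) * |(V *ᵥ y) i|)
      (by positivity), Finset.prod_mul_distrib, ← ENNReal.ofReal_prod_of_nonneg
      (fun i _ => (Real.exp_pos _).le), ← Real.exp_sum, Finset.sum_neg_distrib] at h
    simp only [Finset.prod_const, Finset.card_univ, Fintype.card_fin] at h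
    rw [← h]
    refine lintegral_congr fun u => ?_
    rw [← ENNReal.ofReal_prod_of_nonneg (fun i _ => (Real.exp_pos _).le), ← Real.exp_sum,
      ← ENNReal.ofReal_mul (Real.exp_pos _).le, ← Real.exp_add, ← Finset.sum_neg_distrib,
      ← Finset.sum_add_distrib]
    congr 2
    refine Finset.sum_congr rfl fun i _ => ?_
    rw [Real.exp_sub, Real.exp_sub, Real.exp_log (by norm_num), Real.exp_neg (u i),
      show -2 * t i = -t i + -t i by ring, Real.exp_add, mul_pow, sq_abs]
    field_simp
    ring
  rw [gJ, ← lintegral_const_mul' _ _ (by finiteness), lintegral_congr step, lintegral_lintegral_swap]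
  · refine lintegral_congr fun u => ?_
    rw [lintegral_const_mul' _ _ (by simp)]
    rfl
  · refine Measurable.aemeasurable ?_
    unfold Matrix.mulVec dotProduct Function.uncurry
    fun_prop

lemma gP_logconcave {n k : ℕ} (V : Matrix (Fin n) (Fin k) ℝ) (hV : Function.Injective V.mulVec)
    (s t u v : Fin n → ℝ) {l : ℝ} (h0 : 0 < l) (h1 : l < 1) :
    gP V s u ^ l * gP V t v ^ (1 - l) ≤ gP V (l • s + (1 - l) • t) (l • u + (1 - l) • v) := by
  have h1' : 0 < 1 - l := by linarith
  unfold gP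
  rw [ENNReal.mul_rpow_of_nonneg _ _ h0.le, ENNReal.mul_rpow_of_nonneg _ _ h1'.le, mul_mul_mul_comm]
  refine mul_le_mul' ?_ ?_
  · rw [ENNReal.ofReal_rpow_of_pos (Real.exp_pos _), ENNReal.ofReal_rpow_of_pos (Real.exp_pos _),
      ← ENNReal.ofReal_mul (by positivity), ← Real.exp_mul, ← Real.exp_mul, ← Real.exp_add,
      Finset.sum_mul, Finset.sum_mul, ← Finset.sum_add_distrib]
    refine ENNReal.ofReal_le_ofReal (Real.exp_le_exp.2 (Finset.sum_le_sum fun i _ => ?_))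
    have := convexOn_exp.2 (Set.mem_univ (u i)) (Set.mem_univ (v i)) h0.le h1'.le (by ring)
    simp only [smul_eq_mul, Pi.add_apply, Pi.smul_apply] at *
    linarith
  · refine (gG_logconcave V hV _ _ h0 h1).trans (le_of_eq ?_)
    congr 1
    ext i
    simp only [smul_eq_mul, Pi.add_apply, Pi.smul_apply]
    ring

lemma gJ_logconcave {n k : ℕ} (V : Matrix (Fin n) (Fin k) ℝ) (hV : Function.Injective V.mulVec)
    (s t : Fin n → ℝ) {l : ℝ} (h0 : 0 < l) (h1 : l < 1) :
    gJ V s ^ l * gJ V t ^ (1 - l) ≤ gJ V (l • s + (1 - l) • t) := by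
  have h1' : 0 < 1 - l := by linarith
  have key := pl_pi h0 h1 n (gP_meas V s) (gP_meas V t) (gP_meas V (l • s + (1 - l) • t))
    (fun u v => gP_logconcave V hV s t u v h0 h1)
  rw [← gJ_eq, ← gJ_eq, ← gJ_eq, ENNReal.mul_rpow_of_nonneg _ _ h0.le,
    ENNReal.mul_rpow_of_nonneg _ _ h1'.le, mul_mul_mul_comm,
    ← ENNReal.rpow_add_of_nonneg _ _ h0.le h1'.le, add_sub_cancel, ENNReal.rpow_one] at key
  refine (ENNReal.mul_le_mul_iff_right ?_ ?_).1 key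
  · have : 0 < √Real.pi := by positivity
    simp [this]
  · finiteness

lemma meas_eq {n : ℕ} (H : Submodule ℝ (EuclideanSpace ℝ (Fin n))) [Nontrivial H] :
    ∃ V : Matrix (Fin n) (Fin (Module.finrank ℝ H)) ℝ, Function.Injective V.mulVec ∧ ∃ C : ℝ≥0∞,
      ∀ t : Fin n → ℝ, μH[((Module.finrank ℝ H : ℕ) : ℝ)]
        ({x : EuclideanSpace ℝ (Fin n) | ∑ i, |Real.exp (-t i) * x i| ≤ 1}
          ∩ (H : Set (EuclideanSpace ℝ (Fin n)))) = C * gJ V t ∧ C * gJ V t ≠ ∞ := by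
  set k := Module.finrank ℝ H with hk
  let e : (Fin k → ℝ) ≃L[ℝ] H := ContinuousLinearEquiv.ofFinrankEq (by simp [hk])
  let L : (Fin k → ℝ) →ₗ[ℝ] (Fin n → ℝ) :=
    (WithLp.linearEquiv 2 ℝ (Fin n → ℝ)).toLinearMap ∘ₗ H.subtype ∘ₗ e.toLinearMap
  have hL : ∀ y i, (LinearMap.toMatrix' L *ᵥ y) i = (e y : EuclideanSpace ℝ (Fin n)) i := by
    intro y i
    rw [← Matrix.toLin'_apply, Matrix.toLin'_toMatrix']
    rfl
  set V := LinearMap.toMatrix' L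
  let μ : Measure H := μH[((Module.finrank ℝ H : ℕ) : ℝ)]
  have : μ.IsAddHaarMeasure := isAddHaarMeasure_hausdorffMeasure
  have : (Measure.map e volume).IsAddHaarMeasure := e.isAddHaarMeasure_map volume
  refine ⟨V, fun y z hyz => ?_, ?_⟩
  · apply e.injective
    ext i
    rw [← hL, ← hL, hyz]
  have hμ := Measure.isAddLeftInvariant_eq_smul μ (Measure.map e volume)
  set c := μ.addHaarScalarFactor (Measure.map e volume)
  refine ⟨c * (ENNReal.ofReal (Real.Gamma (k / 1 + 1)))⁻¹, fun t => ?_⟩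
  let g : H → ℝ := fun x => ∑ i, |Real.exp (-t i) * (x : EuclideanSpace ℝ (Fin n)) i|
  have g1 : g 0 = 0 := by simp [g]
  have g2 : ∀ x, g (-x) = g x := by intro x; simp [g]
  have g3 : ∀ x y, g (x + y) ≤ g x + g y := by
    intro x y
    simp only [g, ← Finset.sum_add_distrib]
    refine Finset.sum_le_sum fun i _ => ?_
    simp only [Submodule.coe_add, PiLp.add_apply, mul_add]
    exact abs_add_le _ _
  have g4 : ∀ {x}, g x = 0 → x = 0 := by
    intro x hx
    simp only [g] at hx
    rw [Finset.sum_eq_zero_iff_of_nonneg (fun i _ => abs_nonneg _)] at hx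
    ext i
    have := hx i (Finset.mem_univ _)
    simpa [(Real.exp_pos (-t i)).ne'] using this
  have g5 : ∀ (r : ℝ) x, g (r • x) ≤ |r| * g x := by
    intro r x
    simp only [g, Finset.mul_sum]
    refine Finset.sum_le_sum fun i _ => ?_
    simp only [Submodule.coe_smul, PiLp.smul_apply, smul_eq_mul, abs_mul]
    exact le_of_eq (by ring)
  have m1 := measure_lt_one_eq_integral_div_gamma μ g1 g2 g3 g4 g5 (p := 1) one_pos
  have m2 := measure_le_eq_lt μ g1 g2 g3 g4 g5 1
  have gc : Continuous g := by fun_prop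
  have hset : μH[((Module.finrank ℝ H : ℕ) : ℝ)]
        ({x : EuclideanSpace ℝ (Fin n) | ∑ i, |Real.exp (-t i) * x i| ≤ 1}
          ∩ (H : Set (EuclideanSpace ℝ (Fin n)))) = μ {x | g x ≤ 1} := by
    have := (isometry_subtype_coe (s := (H : Set (EuclideanSpace ℝ (Fin n))))).hausdorffMeasure_preimage
      (d := ((Module.finrank ℝ H : ℕ) : ℝ)) (Or.inl (by positivity))
      {x : EuclideanSpace ℝ (Fin n) | ∑ i, |Real.exp (-t i) * x i| ≤ 1}
    rw [Subtype.range_coe] at this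
    exact this.symm
  have pos : 0 < μ {x | g x < 1} :=
    (isOpen_lt gc continuous_const).measure_pos μ ⟨0, by simp [g1]⟩
  simp only [Real.rpow_one] at m1
  have hIntg : Integrable (fun x => Real.exp (-g x)) μ := by
    by_contra hcon
    rw [m1, integral_undef hcon] at pos
    simp at pos
  have hG : 0 < Real.Gamma (k / 1 + 1) := Real.Gamma_pos_of_pos (by positivity)
  have hval : μ {x | g x < 1} = c * (ENNReal.ofReal (Real.Gamma (k / 1 + 1)))⁻¹ * gJ V t := by
    rw [m1, ENNReal.ofReal_div_of_pos hG, ofReal_integral_eq_lintegral_ofReal hIntg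
      (ae_of_all _ fun x => (Real.exp_pos _).le), hμ]
    rw [lintegral_smul_measure, lintegral_map (by fun_prop) e.continuous.measurable,
      div_eq_mul_inv, mul_right_comm]
    have hJ : ∫⁻ y, ENNReal.ofReal (Real.exp (-g (e y))) = gJ V t := by
      unfold gJ
      simp only [g, hL, abs_mul, Real.abs_exp]
    rw [hJ]
    rfl
  rw [hset, m2, ← hval]
  refine ⟨rfl, ?_⟩
  rw [m1]; exact ENNReal.ofReal_ne_top

theorem stmt13 (n : ℕ) (H : Submodule ℝ (EuclideanSpace ℝ (Fin n)))
    (f : (Fin n → ℝ) → ℝ)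
    (hf : ∀ t, f t = (μH[((Module.finrank ℝ H : ℕ) : ℝ)]
        ({x : EuclideanSpace ℝ (Fin n) | ∑ i, |Real.exp (-t i) * x i| ≤ 1}
          ∩ (H : Set (EuclideanSpace ℝ (Fin n))))).toReal) :
    ∀ s t : Fin n → ℝ, ∀ l : ℝ, 0 ≤ l → l ≤ 1 →
      f s ^ l * f t ^ (1 - l) ≤ f (l • s + (1 - l) • t) := by
  intro s t l h0 h1
  rcases h0.eq_or_lt with rfl | h0
  · simp
  rcases h1.eq_or_lt with rfl | h1
  · simp
  have h1' : 0 < 1 - l := by linarith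
  rcases subsingleton_or_nontrivial H with hH | hH
  · have hb : H = ⊥ := Submodule.subsingleton_iff_eq_bot.1 hH
    have hc : ∀ w, f w = f 0 := by
      intro w
      rw [hf, hf]
      congr 2
      ext x
      simp only [hb, Set.mem_inter_iff, Set.mem_ofPred_eq, SetLike.mem_coe, Submodule.mem_bot]
      constructor <;> rintro ⟨_, rfl⟩ <;> simp
    rw [hc s, hc t, hc (l • s + _)]
    have : 0 ≤ f 0 := by rw [hf]; exact ENNReal.toReal_nonneg
    rw [← Real.rpow_add' this (by simp)]
    simp
  · obtain ⟨V, hV, C, hC⟩ := meas_eq H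
    have hf' : ∀ t, f t = (C * gJ V t).toReal := fun t => by rw [hf, (hC t).1]
    rw [hf', hf', hf', ENNReal.toReal_rpow, ENNReal.toReal_rpow, ← ENNReal.toReal_mul]
    refine ENNReal.toReal_mono (hC _).2 ?_
    rw [ENNReal.mul_rpow_of_nonneg _ _ h0.le, ENNReal.mul_rpow_of_nonneg _ _ h1'.le,
      mul_mul_mul_comm, ← ENNReal.rpow_add_of_nonneg _ _ h0.le h1'.le, add_sub_cancel,
      ENNReal.rpow_one]
    exact mul_le_mul_right (gJ_logconcave V hV s t h0 h1) _
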